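/- arXiv:2011.10226 — 2 statements merged into one kernel-verified Lean document; each statement's English description precedes it below -/
import Mathlib

section
/- Let k be a field of characteristic p > 0, let n ≥ 1, set q = p^n, and let c be a nonzero element of k. Then the kernel of the k-algebra homomorphism from the polynomial ring k[s,ξ] (in two variables) to the polynomial ring k[x] determined by s ↦ c·x^q and ξ ↦ c·x^{q−1} is the principal ideal generated by ξ^q − c·s^{q−1}. In particular, the quotient ring k[s,ξ]/(ξ^q − c·s^{q−1}) is an integral domain that embeds into k[x] with image the subalgebra generated by c·x^q and c·x^{q−1}. -/
/-- The inverse of the parametrization on the level of exponents: if `m = q * a + (q - 1) * b`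
with `b` reduced modulo `q`, then `m` determines `a` and `b`. -/
theorem exponent_eq_of_reduced (t a d b₀ : ℕ) (hb : b₀ < t + 2) :
    (t + 1) * ((t + 2) * a + (t + 1) * ((t + 2) * d + b₀)) % (t + 2) = b₀ ∧
      ((t + 2) * a + (t + 1) * ((t + 2) * d + b₀) - (t + 1) * b₀) / (t + 2)
        = a + (t + 1) * d := by
  constructor
  · have h : (t + 1) * ((t + 2) * a + (t + 1) * ((t + 2) * d + b₀))
        = b₀ + (t + 2) * ((t + 1) * a + (t + 1) * (t + 1) * d + t * b₀) := by ring
    rw [h, Nat.add_mul_mod_self_left, Nat.mod_eq_of_lt hb]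
  · have h : (t + 2) * a + (t + 1) * ((t + 2) * d + b₀)
        = (t + 2) * (a + (t + 1) * d) + (t + 1) * b₀ := by ring
    rw [h, Nat.add_sub_cancel, Nat.mul_div_cancel_left _ (by omega)]

open MvPolynomial in
/-- The kernel of `s ↦ c x ^ q`, `ξ ↦ c x ^ (q - 1)` is generated by `ξ ^ q - c s ^ (q - 1)`. -/
theorem ker_aeval_monomial_curve {k : Type*} [Field k] {q : ℕ} (hq : 2 ≤ q) {c : k}
    (hc : c ≠ 0) :
    RingHom.ker
      (aeval
        (fun i : Fin 2 =>
          if i = 0 then Polynomial.C c * Polynomial.X ^ q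
          else Polynomial.C c * Polynomial.X ^ (q - 1)) :
        MvPolynomial (Fin 2) k →ₐ[k] Polynomial k)
      = Ideal.span {(X 1 : MvPolynomial (Fin 2) k) ^ q - C c * (X 0) ^ (q - 1)} := by
  obtain ⟨t, rfl⟩ := Nat.exists_eq_add_of_le' hq
  rw [show t + 2 - 1 = t + 1 from rfl]
  set φ : MvPolynomial (Fin 2) k →ₐ[k] Polynomial k := aeval (fun i : Fin 2 =>
    if i = 0 then Polynomial.C c * Polynomial.X ^ (t + 2)
    else Polynomial.C c * Polynomial.X ^ (t + 1)) with hφ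
  set I : Ideal (MvPolynomial (Fin 2) k) :=
    Ideal.span {(X 1 : MvPolynomial (Fin 2) k) ^ (t + 2) - C c * (X 0) ^ (t + 1)} with hI
  have hφ0 : φ (X 0) = Polynomial.C c * Polynomial.X ^ (t + 2) := by simp [hφ]
  have hφ1 : φ (X 1) = Polynomial.C c * Polynomial.X ^ (t + 1) := by simp [hφ]
  apply le_antisymm
  · -- a linear left inverse of the induced map on the quotient
    let b : ℕ → ℕ := fun m => (t + 1) * m % (t + 2)
    let a : ℕ → ℕ := fun m => (m - (t + 1) * b m) / (t + 2)
    let ψ : Polynomial k →ₗ[k] MvPolynomial (Fin 2) k ⧸ I :=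
      (Polynomial.basisMonomials k).constr k fun m =>
        c⁻¹ ^ (a m + b m) • Ideal.Quotient.mkₐ k I (X 0 ^ a m * X 1 ^ b m)
    have hψ (m : ℕ) : ψ (Polynomial.X ^ m) =
        c⁻¹ ^ (a m + b m) • Ideal.Quotient.mkₐ k I (X 0 ^ a m * X 1 ^ b m) := by
      have h := (Polynomial.basisMonomials k).constr_basis k (fun m =>
        c⁻¹ ^ (a m + b m) • Ideal.Quotient.mkₐ k I (X 0 ^ a m * X 1 ^ b m)) m
      rw [Polynomial.coe_basisMonomials] at h
      rwa [← Polynomial.monomial_one_right_eq_X_pow]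
    have hrel : Ideal.Quotient.mkₐ k I (X 1) ^ (t + 2)
        = c • Ideal.Quotient.mkₐ k I (X 0) ^ (t + 1) := by
      rw [← map_pow, ← map_pow, ← map_smul, smul_eq_C_mul]
      exact Ideal.Quotient.eq.2 (Ideal.subset_span rfl)
    have hψφ : ψ ∘ₗ φ.toLinearMap = (Ideal.Quotient.mkₐ k I).toLinearMap := by
      refine (basisMonomials (Fin 2) k).ext fun e => ?_
      have he : basisMonomials (Fin 2) k e = X 0 ^ e 0 * X 1 ^ e 1 := by
        rw [coe_basisMonomials]
        beta_reduce
        rw [monomial_eq, Finsupp.prod_fintype _ _ (by simp)]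
        simp
      have hφe (i j : ℕ) : φ (X 0 ^ i * X 1 ^ j)
          = c ^ (i + j) • Polynomial.X ^ ((t + 2) * i + (t + 1) * j) := by
        rw [map_mul, map_pow, map_pow, hφ0, hφ1, Polynomial.smul_eq_C_mul, map_pow]
        ring
      rw [he]
      generalize e 0 = i
      obtain ⟨d, r, hr, hj⟩ : ∃ d r, r < t + 2 ∧ e 1 = (t + 2) * d + r :=
        ⟨e 1 / (t + 2), e 1 % (t + 2), Nat.mod_lt _ (by omega), (Nat.div_add_mod _ _).symm⟩
      rw [hj]
      obtain ⟨h₁, h₂⟩ := exponent_eq_of_reduced t i d r hr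
      have hb : b ((t + 2) * i + (t + 1) * ((t + 2) * d + r)) = r := h₁
      have ha : a ((t + 2) * i + (t + 1) * ((t + 2) * d + r)) = i + (t + 1) * d := by
        simp only [a, hb, h₂]
      rw [LinearMap.comp_apply, AlgHom.toLinearMap_apply, AlgHom.toLinearMap_apply, hφe,
        map_smul, hψ, ha, hb, smul_smul]
      have hcoef : c ^ (i + ((t + 2) * d + r)) * c⁻¹ ^ (i + (t + 1) * d + r) = c ^ d := by
        rw [show i + ((t + 2) * d + r) = d + (i + (t + 1) * d + r) by ring, pow_add, mul_assoc,
          ← mul_pow, mul_inv_cancel₀ hc, one_pow, mul_one]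
      rw [hcoef, map_mul, map_mul, map_pow, map_pow, map_pow, map_pow, pow_add _ _ r,
        pow_mul _ _ d, hrel, smul_pow, pow_add, pow_mul, smul_mul_assoc, mul_smul_comm, mul_assoc]
    intro f hf
    have h := LinearMap.congr_fun hψφ f
    rw [LinearMap.comp_apply, AlgHom.toLinearMap_apply, (RingHom.mem_ker).1 hf, map_zero] at h
    exact Ideal.Quotient.eq_zero_iff_mem.1 h.symm
  · rw [hI, Ideal.span_singleton_le_iff_mem, RingHom.mem_ker, ← algebraMap_eq, map_sub, map_mul,
      map_pow, map_pow, AlgHom.commutes, hφ0, hφ1, ← Polynomial.C_eq_algebraMap]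
    ring


/-- Let `k` be a field of characteristic `p > 0`, `n ≥ 1`, `q = p^n`, and `c ∈ k` nonzero.
The kernel of the `k`-algebra homomorphism `k[s,ξ] → k[x]` determined by `s ↦ c·x^q` and
`ξ ↦ c·x^(q−1)` is the principal ideal generated by `ξ^q − c·s^(q−1)`. In particular the
quotient `k[s,ξ]/(ξ^q − c·s^(q−1))` is an integral domain that embeds into `k[x]` with
image the subalgebra generated by `c·x^q` and `c·x^(q−1)`.
Here `s = MvPolynomial.X 0` and `ξ = MvPolynomial.X 1`. -/
theorem chart_at_infinity_of_cyclic_cover (k : Type*) [Field k] (p : ℕ) (hp : p.Prime)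
    [CharP k p] (n : ℕ) (hn : 1 ≤ n) (q : ℕ) (hq : q = p ^ n) (c : k) (hc : c ≠ 0) :
    RingHom.ker
      (MvPolynomial.aeval
        (fun i : Fin 2 =>
          if i = 0 then Polynomial.C c * Polynomial.X ^ q
          else Polynomial.C c * Polynomial.X ^ (q - 1)) :
        MvPolynomial (Fin 2) k →ₐ[k] Polynomial k)
      = Ideal.span
          {(MvPolynomial.X 1 : MvPolynomial (Fin 2) k) ^ q
            - MvPolynomial.C c * (MvPolynomial.X 0) ^ (q - 1)} ∧
    IsDomain
      (MvPolynomial (Fin 2) k ⧸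
        Ideal.span
          {(MvPolynomial.X 1 : MvPolynomial (Fin 2) k) ^ q
            - MvPolynomial.C c * (MvPolynomial.X 0) ^ (q - 1)}) ∧
    (MvPolynomial.aeval
        (fun i : Fin 2 =>
          if i = 0 then Polynomial.C c * Polynomial.X ^ q
          else Polynomial.C c * Polynomial.X ^ (q - 1)) :
        MvPolynomial (Fin 2) k →ₐ[k] Polynomial k).range
      = Algebra.adjoin k
          {Polynomial.C c * Polynomial.X ^ q, Polynomial.C c * Polynomial.X ^ (q - 1)} := by
  have hq2 : 2 ≤ q := hq ▸ hp.two_le.trans (Nat.le_self_pow (by omega) p)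
  have hker := ker_aeval_monomial_curve hq2 hc
  refine ⟨hker, ?_, ?_⟩
  · rw [← hker]
    have := RingHom.ker_isPrime (MvPolynomial.aeval
      (fun i : Fin 2 =>
        if i = 0 then Polynomial.C c * Polynomial.X ^ q
        else Polynomial.C c * Polynomial.X ^ (q - 1)) :
      MvPolynomial (Fin 2) k →ₐ[k] Polynomial k)
    exact Ideal.Quotient.isDomain _
  · rw [← Algebra.adjoin_range_eq_range_aeval]
    congr 1
    ext f
    simp [Fin.exists_fin_two, eq_comm]
end

section
/- Let k be a field and let q ≥ 2 be an integer. Consider the k-subalgebra A = k[X^q, X^{q−1}] of the polynomial ring k[X] generated by X^q and X^{q−1}. Then: (i) the field of fractions of A, taken inside the field k(X) of rational functions, is all of k(X); and (ii) the integral closure of A in k(X) is exactly the image of k[X] in k(X), i.e. the normalization of A is k[X]. -/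
open Polynomial in
theorem exists_ne_zero_mul_mem_of_X_pow_mem {k : Type*} [Field k] {A : Subalgebra k k[X]} {n : ℕ}
    (h₁ : (X : k[X]) ^ n ∈ A) (h₂ : (X : k[X]) ^ (n + 1) ∈ A) (p : k[X]) :
    ∃ b ∈ A, b ≠ 0 ∧ b * p ∈ A := by
  have hC (a : k) : (C a : k[X]) ∈ A := A.algebraMap_mem a
  induction p using Polynomial.induction_on with
  | C a => exact ⟨1, A.one_mem, one_ne_zero, by simpa using hC a⟩
  | add p r hp hr =>
    obtain ⟨b, hb, hb0, hbp⟩ := hp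
    obtain ⟨c, hc, hc0, hcr⟩ := hr
    refine ⟨b * c, A.mul_mem hb hc, mul_ne_zero hb0 hc0, ?_⟩
    have h : b * c * (p + r) = c * (b * p) + b * (c * r) := by ring
    exact h ▸ A.add_mem (A.mul_mem hc hbp) (A.mul_mem hb hcr)
  | monomial m a hp =>
    obtain ⟨b, hb, hb0, hbp⟩ := hp
    refine ⟨X ^ n * b, A.mul_mem h₁ hb, mul_ne_zero (pow_ne_zero _ X_ne_zero) hb0, ?_⟩
    have h : X ^ n * b * (C a * X ^ (m + 1)) = X ^ (n + 1) * (b * (C a * X ^ m)) := by ring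
    exact h ▸ A.mul_mem h₂ hbp

open Polynomial in
theorem Polynomial.isIntegral_of_X_pow_mem {k : Type*} [Field k] {A : Subalgebra k k[X]} {n : ℕ}
    (hn : 0 < n) (h : (X : k[X]) ^ n ∈ A) (p : k[X]) : IsIntegral A p := by
  have hX : IsIntegral A (X : k[X]) :=
    IsIntegral.of_pow hn (isIntegral_algebraMap (x := (⟨X ^ n, h⟩ : A)))
  have hC (a : k) : IsIntegral A (C a : k[X]) :=
    isIntegral_algebraMap (x := algebraMap k A a)
  induction p using Polynomial.induction_on' with
  | add p r hp hr => exact hp.add hr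
  | monomial m a => exact C_mul_X_pow_eq_monomial (R := k) ▸ (hC a).mul (hX.pow m)

/-- Let `k` be a field and `q ≥ 2`. Let `A = k[X^q, X^(q−1)] ⊆ k[X]` be the `k`-subalgebra
generated by `X^q` and `X^(q−1)`. Then (i) the field of fractions of `A`, taken inside the
rational function field `k(X)`, is all of `k(X)`: every `f ∈ k(X)` is a quotient of two
elements of `A`; and (ii) the integral closure of `A` in `k(X)` is exactly the image of
`k[X]` in `k(X)`, i.e. the normalization of `A` is `k[X]`. -/
theorem normalization_of_chart_at_infinity (k : Type*) [Field k] (q : ℕ) (hq : 2 ≤ q)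
    (A : Subalgebra k (Polynomial k))
    (hA : A = Algebra.adjoin k
        {(Polynomial.X : Polynomial k) ^ q, (Polynomial.X : Polynomial k) ^ (q - 1)}) :
    (∀ f : RatFunc k, ∃ a b : A, b ≠ 0 ∧
        f = algebraMap (Polynomial k) (RatFunc k) (a : Polynomial k) /
              algebraMap (Polynomial k) (RatFunc k) (b : Polynomial k)) ∧
    (∀ f : RatFunc k,
        ((algebraMap (Polynomial k) (RatFunc k)).comp A.val.toRingHom).IsIntegralElem f ↔
          f ∈ Set.range (algebraMap (Polynomial k) (RatFunc k))) := by
  obtain ⟨n, rfl⟩ : ∃ n, q = n + 1 := ⟨q - 1, by omega⟩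
  have h₂ : (Polynomial.X : Polynomial k) ^ (n + 1) ∈ A := hA ▸ Algebra.subset_adjoin (by simp)
  have h₁ : (Polynomial.X : Polynomial k) ^ n ∈ A := hA ▸ Algebra.subset_adjoin (by simp)
  refine ⟨fun f => ?_, fun f => ⟨fun hf => ?_, ?_⟩⟩
  · obtain ⟨p, r, hr, rfl⟩ := IsFractionRing.div_surjective (A := Polynomial k) f
    obtain ⟨b, hb, hb0, hbp⟩ := exists_ne_zero_mul_mem_of_X_pow_mem h₁ h₂ p
    obtain ⟨c, hc, hc0, hcr⟩ := exists_ne_zero_mul_mem_of_X_pow_mem h₁ h₂ r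
    have hr0 := nonZeroDivisors.ne_zero hr
    refine ⟨⟨c * (b * p), A.mul_mem hc hbp⟩, ⟨b * (c * r), A.mul_mem hb hcr⟩, fun h => ?_, ?_⟩
    · exact mul_ne_zero hb0 (mul_ne_zero hc0 hr0) (congrArg Subtype.val h)
    · have hb' := RatFunc.algebraMap_ne_zero hb0
      have hc' := RatFunc.algebraMap_ne_zero hc0
      have hr' := RatFunc.algebraMap_ne_zero hr0
      simp only [map_mul]
      field_simp
  · obtain ⟨P, hP, hPf⟩ := hf
    exact IsIntegrallyClosed.isIntegral_iff.mp
      ⟨P.map A.val.toRingHom, hP.map _, by rwa [Polynomial.eval₂_map]⟩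
  · rintro ⟨p, rfl⟩
    obtain ⟨P, hP, hPp⟩ := Polynomial.isIntegral_of_X_pow_mem n.succ_pos h₂ p
    refine ⟨P, hP, ?_⟩
    rw [← map_zero (algebraMap (Polynomial k) (RatFunc k)), ← hPp, Polynomial.hom_eval₂]
    rfl
end
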